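/- The complete bipartite graph K_{6,123} is not 4-choosable; equivalently, ch(K_{6,123}) = 5 and hence n_6 ≤ 123. -/

import Mathlib

/-- A graph `G` is `k`-choosable if for every assignment of lists of `k` colors
to the vertices there is a proper coloring choosing each vertex's color from its list. -/
def Choosable {V : Type*} (G : SimpleGraph V) (k : ℕ) : Prop :=
  ∀ L : V → Finset ℕ, (∀ v, (L v).card = k) →
    ∃ c : V → ℕ, (∀ v, c v ∈ L v) ∧ ∀ u w, G.Adj u w → c u ≠ c w

/-- The choice number of `G` is the least `k` such that `G` is `k`-choosable. -/
noncomputable def choiceNumber {V : Type*} (G : SimpleGraph V) : ℕ :=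
  sInf {k | Choosable G k}

/-- `nm m` is the smallest integer `n` such that `ch (K_{m,n}) = m - 1`. -/
noncomputable def nm (m : ℕ) : ℕ :=
  sInf {n | choiceNumber (completeBipartiteGraph (Fin m) (Fin n)) = m - 1}

section

open Finset

/-- A proper list coloring with `k` colors per list yields one with more colors per list. -/
theorem Choosable.mono {V : Type*} {G : SimpleGraph V} {k l : ℕ} (h : Choosable G k)
    (hkl : k ≤ l) : Choosable G l := by
  intro L hL
  choose L' hsub hcard using fun v => exists_subset_card_eq (hkl.trans_eq (hL v).symm)
  obtain ⟨c, hc, hadj⟩ := h L' hcard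
  exact ⟨c, fun v => hsub v (hc v), hadj⟩

/-- A complete bipartite graph can be colored from its lists as soon as some set of colors meets
all lists on the left and contains no list on the right. -/
theorem exists_coloring_of_hitting_set {V W : Type*} {L : V ⊕ W → Finset ℕ} (S : Finset ℕ)
    (hA : ∀ v, ∃ x ∈ L (.inl v), x ∈ S) (hB : ∀ w, ¬ L (.inr w) ⊆ S) :
    ∃ c : V ⊕ W → ℕ, (∀ v, c v ∈ L v) ∧
      ∀ u w, (completeBipartiteGraph V W).Adj u w → c u ≠ c w := by
  choose a haL haS using hA
  choose b hbL hbS using fun w => not_subset.1 (hB w)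
  refine ⟨Sum.elim a b, by rintro (v | w) <;> simp [haL, hbL], ?_⟩
  rintro (u | u) (w | w) h
  · simp at h
  · exact fun e => hbS w ((show a u = b w from e) ▸ haS u)
  · exact fun e => hbS u ((show b u = a w from e) ▸ haS w)
  · simp at h

/-- Given pairwise disjoint sets `D i` of size `k` and not too many sets `B j`, some transversal of
the `D i` contains, even together with a small set `X`, none of the `B j`. -/
theorem exists_transversal_not_superset {ι κ α : Type*} [Fintype ι] [DecidableEq ι] [Nonempty ι]
    [Fintype κ] [DecidableEq α] {k : ℕ} (D : ι → Finset α) (B : κ → Finset α) (X : Finset α)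
    (hD : ∀ i, #(D i) = k) (hdisj : Pairwise fun i j => Disjoint (D i) (D j))
    (hB : ∀ j, #X + Fintype.card ι ≤ #(B j) + 1)
    (hcard : Fintype.card κ * k < k ^ Fintype.card ι) :
    ∃ d : ι → α, (∀ i, d i ∈ D i) ∧ ∀ j, ¬ B j ⊆ X ∪ univ.image d := by
  by_contra! hcon
  let bad : κ → Finset (ι → α) := fun j =>
    (Fintype.piFinset D).filter fun d => B j ⊆ X ∪ univ.image d
  have hbad : ∀ j, #(bad j) ≤ k := by
    intro j
    obtain h | ⟨d₀, hd₀⟩ := (bad j).eq_empty_or_nonempty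
    · simp [h]
    obtain ⟨hd₀D, hd₀B⟩ : (∀ i, d₀ i ∈ D i) ∧ B j ⊆ X ∪ univ.image d₀ := by
      simpa [bad] using hd₀
    have hhit : Fintype.card ι ≤ #(univ.filter fun i => d₀ i ∈ B j \ X) + 1 := by
      have h₁ : B j \ X ⊆ (univ.filter fun i => d₀ i ∈ B j \ X).image d₀ := by
        intro x hx
        have hx' := hd₀B (mem_sdiff.1 hx).1
        rw [mem_union, or_iff_right (mem_sdiff.1 hx).2, mem_image] at hx'
        obtain ⟨i, -, rfl⟩ := hx'
        exact mem_image_of_mem _ (by simpa using hx)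
      have h₂ := (card_le_card h₁).trans card_image_le
      have h₃ := le_card_sdiff X (B j)
      have h₄ := hB j
      omega
    obtain ⟨m, hm⟩ : ∃ m, ∀ i, i ≠ m → d₀ i ∈ B j \ X := by
      have h : #(univ.filter fun i => ¬ d₀ i ∈ B j \ X) ≤ 1 := by
        have := card_filter_add_card_filter_not (s := univ) (fun i => d₀ i ∈ B j \ X)
        rw [card_univ] at this
        omega
      obtain ⟨m, hm⟩ := card_le_one_iff_subset_singleton.1 h
      refine ⟨m, fun i hi => by_contra fun hn => hi ?_⟩
      simpa using hm (mem_filter.2 ⟨mem_univ i, hn⟩)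
    have hsub : bad j ⊆ (D m).image (Function.update d₀ m) := by
      intro d hd
      obtain ⟨hdD, hdB⟩ : (∀ i, d i ∈ D i) ∧ B j ⊆ X ∪ univ.image d := by simpa [bad] using hd
      refine mem_image.2 ⟨d m, hdD m, funext fun i => ?_⟩
      obtain rfl | hi := eq_or_ne i m
      · simp
      rw [Function.update_of_ne hi]
      have hx := mem_sdiff.1 (hm i hi)
      have hx' := hdB hx.1
      rw [mem_union, or_iff_right hx.2, mem_image] at hx'
      obtain ⟨l, -, hl⟩ := hx'
      obtain rfl | hli := eq_or_ne l i
      · exact hl.symm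
      · exact absurd (hl ▸ hdD l) (disjoint_right.1 (hdisj hli) (hd₀D i))
    exact (card_le_card hsub).trans (card_image_le.trans_eq (hD m))
  have hcover : Fintype.piFinset D ⊆ univ.biUnion bad := by
    intro d hd
    obtain ⟨j, hj⟩ := hcon d (Fintype.mem_piFinset.1 hd)
    exact mem_biUnion.2 ⟨j, mem_univ j, mem_filter.2 ⟨hd, hj⟩⟩
  have h := (card_le_card hcover).trans (card_biUnion_le_card_mul _ _ k fun j _ => hbad j)
  rw [Fintype.card_piFinset, prod_congr rfl fun i _ => hD i, prod_const, card_univ,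
    card_univ] at h
  omega

/-- Six lists of size five can be hit by a set of colors containing none of `123` given sets of
size five. -/
theorem exists_hitting_set_of_card_five (A : Fin 6 → Finset ℕ) (B : Fin 123 → Finset ℕ)
    (hA : ∀ i, #(A i) = 5) (hB : ∀ j, #(B j) = 5) :
    ∃ S : Finset ℕ, (∀ i, ∃ x ∈ A i, x ∈ S) ∧ ∀ j, ¬ B j ⊆ S := by
  have hne : ∀ i, (A i).Nonempty := fun i => card_pos.1 (by simp [hA])
  choose a ha using hne
  -- A partial hitting set of size two suffices if the four lists it may miss are disjoint.
  have extend : ∀ (R : Finset (Fin 6)) (X : Finset ℕ), #R = 4 → #X ≤ 2 →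
      (∀ i ∉ R, ∃ x ∈ A i, x ∈ X) → (∀ i ∈ R, ∀ j ∈ R, i ≠ j → Disjoint (A i) (A j)) →
      ∃ S : Finset ℕ, (∀ i, ∃ x ∈ A i, x ∈ S) ∧ ∀ j, ¬ B j ⊆ S := by
    intro R X hR hX hhit hdisj
    have : Nonempty R := (card_pos.1 (by omega : 0 < #R)).to_subtype
    obtain ⟨d, hd, hdB⟩ := exists_transversal_not_superset (fun i : R => A i) B X
      (fun i => hA i) (fun i j hij => hdisj i i.2 j j.2 (Subtype.coe_ne_coe.2 hij))
      (by intro j; rw [hB, Fintype.card_coe]; omega)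
      (by rw [Fintype.card_coe, hR, Fintype.card_fin]; norm_num)
    refine ⟨_, fun i => ?_, hdB⟩
    by_cases hi : i ∈ R
    · exact ⟨d ⟨i, hi⟩, hd ⟨i, hi⟩, mem_union_right _ (mem_image_of_mem _ (mem_univ _))⟩
    · obtain ⟨x, hx, hxX⟩ := hhit i hi
      exact ⟨x, hx, mem_union_left _ hxX⟩
  by_cases hshare : ∃ p q x, p ≠ q ∧ x ∈ A p ∧ x ∈ A q
  · obtain ⟨p, q, x, hpq, hxp, hxq⟩ := hshare
    have hpair : #({p, q} : Finset (Fin 6)) = 2 := card_pair hpq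
    by_cases hshare' : ∃ r s y, r ≠ s ∧ r ∉ ({p, q} : Finset _) ∧ s ∉ ({p, q} : Finset _) ∧
        y ∈ A r ∧ y ∈ A s
    · obtain ⟨r, s, y, hrs, hr, hs, hyr, hys⟩ := hshare'
      have hquad : #({r, s, p, q} : Finset (Fin 6)) = 4 := by
        rw [card_insert_of_notMem (by simp only [mem_insert, not_or] at hr ⊢; exact ⟨hrs, hr⟩),
          card_insert_of_notMem hs, hpair]
      refine ⟨{x, y} ∪ ({r, s, p, q} : Finset (Fin 6))ᶜ.image a, fun i => ?_, fun j hj => ?_⟩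
      · by_cases hi : i ∈ ({r, s, p, q} : Finset (Fin 6))
        · simp only [mem_insert, mem_singleton] at hi
          rcases hi with rfl | rfl | rfl | rfl
          · exact ⟨y, hyr, by simp⟩
          · exact ⟨y, hys, by simp⟩
          · exact ⟨x, hxp, by simp⟩
          · exact ⟨x, hxq, by simp⟩
        · exact ⟨a i, ha i, mem_union_right _ (mem_image_of_mem _ (mem_compl.2 hi))⟩
      · have h₁ := (card_le_card hj).trans (card_union_le _ _)
        have h₂ : #(({r, s, p, q} : Finset (Fin 6))ᶜ.image a) ≤ 2 :=
          card_image_le.trans (by rw [card_compl, hquad, Fintype.card_fin])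
        have h₃ : #({x, y} : Finset ℕ) ≤ 2 := card_le_two
        rw [hB] at h₁
        omega
    · push Not at hshare'
      refine extend {p, q}ᶜ {x} (by rw [card_compl, hpair, Fintype.card_fin]) (by simp)
        (fun i hi => ⟨x, ?_, by simp⟩) fun i hi j hj hij => disjoint_left.2 fun y hyi hyj =>
          hshare' i j y hij (mem_compl.1 hi) (mem_compl.1 hj) hyi hyj
      rw [mem_compl, not_not, mem_insert, mem_singleton] at hi
      rcases hi with rfl | rfl <;> assumption
  · push Not at hshare
    refine extend {0, 1}ᶜ {a 0, a 1} (by decide) card_le_two (fun i hi => ⟨a i, ha i, ?_⟩)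
      fun i _ j _ hij => disjoint_left.2 fun y hyi hyj => hshare i j y hij hyi hyj
    rw [mem_compl, not_not, mem_insert, mem_singleton] at hi
    rcases hi with rfl | rfl <;> simp

theorem K6_123_five_choosable : Choosable (completeBipartiteGraph (Fin 6) (Fin 123)) 5 := by
  intro L hL
  obtain ⟨S, hA, hB⟩ := exists_hitting_set_of_card_five (fun i => L (.inl i)) (fun j => L (.inr j))
    (fun i => hL _) (fun j => hL _)
  exact exists_coloring_of_hitting_set S hA hB

/-- Lists on the six-vertex side: no color lies in three of them, and the last list is disjoint from
the others. -/
def leftLists : Fin 6 → Finset ℕ :=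
  ![{0, 1, 2, 3}, {0, 4, 5, 6}, {1, 4, 7, 8}, {2, 5, 8, 9}, {3, 7, 9, 10}, {11, 12, 13, 14}]

/-- Triples of colors meeting each of the first five lists of `leftLists`. -/
def blockingTriples : List (List ℕ) :=
  [[2, 3, 4], [1, 3, 5], [3, 4, 5], [0, 2, 7], [2, 4, 7], [0, 5, 7], [1, 5, 7], [2, 5, 7],
    [3, 5, 7], [2, 6, 7], [0, 3, 8], [3, 4, 8], [3, 5, 8], [3, 6, 8], [0, 7, 8], [0, 1, 9],
    [0, 4, 9], [1, 4, 9], [2, 4, 9], [3, 4, 9], [1, 5, 9], [1, 6, 9], [0, 7, 9], [0, 8, 9],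
    [2, 4, 10], [1, 5, 10], [0, 8, 10]]

/-- Quadruples such that every set meeting each of the first five lists of `leftLists` contains one
of them or a member of `blockingTriples`. -/
def blockingQuadruples : List (List ℕ) :=
  [[0, 1, 2, 3], [1, 2, 3, 6], [1, 4, 7, 8], [1, 6, 7, 8], [3, 6, 7, 9], [2, 5, 8, 9],
    [2, 6, 8, 9], [0, 1, 2, 10], [0, 4, 5, 10], [1, 2, 6, 10], [1, 4, 8, 10], [2, 5, 8, 10],
    [1, 6, 8, 10], [2, 6, 8, 10]]

/-- The lists on the large side of the bipartite graph. -/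
def rightLists : List (List ℕ) :=
  (blockingTriples.flatMap fun t => [11, 12, 13, 14].map fun x => x :: t) ++ blockingQuadruples

theorem length_rightLists : rightLists.length = 122 := by
  decide +kernel

theorem card_of_mem_rightLists : ∀ b ∈ rightLists, #b.toFinset = 4 := by
  decide +kernel

theorem exists_blocking_subset : ∀ x₀ ∈ leftLists 0, ∀ x₁ ∈ leftLists 1, ∀ x₂ ∈ leftLists 2,
    ∀ x₃ ∈ leftLists 3, ∀ x₄ ∈ leftLists 4,
    ∃ b ∈ blockingTriples ++ blockingQuadruples, ∀ y ∈ b, y ∈ [x₀, x₁, x₂, x₃, x₄] := by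
  decide +kernel

theorem exists_mem_rightLists_subset (c : Fin 6 → ℕ) (hc : ∀ i, c i ∈ leftLists i) :
    ∃ b ∈ rightLists, ∀ y ∈ b, ∃ i, y = c i := by
  obtain ⟨b, hb, hsub⟩ := exists_blocking_subset _ (hc 0) _ (hc 1) _ (hc 2) _ (hc 3) _ (hc 4)
  have hsub' : ∀ y ∈ b, ∃ i, y = c i := by
    intro y hy
    have h := hsub y hy
    simp only [List.mem_cons, List.not_mem_nil, or_false] at h
    rcases h with h | h | h | h | h <;> exact ⟨_, h⟩
  rcases List.mem_append.1 hb with ht | hq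
  · have h₅ : c 5 ∈ [11, 12, 13, 14] := by simpa [leftLists] using hc 5
    refine ⟨c 5 :: b, List.mem_append_left _ (List.mem_flatMap.2 ⟨b, ht,
      List.mem_map.2 ⟨_, h₅, rfl⟩⟩), fun y hy => ?_⟩
    rcases List.mem_cons.1 hy with rfl | hy
    · exact ⟨5, rfl⟩
    · exact hsub' y hy
  · exact ⟨b, List.mem_append_right _ hq, hsub'⟩

theorem not_choosable_four : ¬ Choosable (completeBipartiteGraph (Fin 6) (Fin 123)) 4 := by
  intro h
  obtain ⟨c, hc, hadj⟩ := h
    (Sum.elim leftLists fun j => (rightLists.getD j [0, 1, 2, 3]).toFinset) (by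
      rintro (i | j)
      · revert i; decide
      · rw [Sum.elim_inr]
        by_cases hj : (j : ℕ) < rightLists.length
        · rw [List.getD_eq_getElem _ _ hj]
          exact card_of_mem_rightLists _ (List.getElem_mem hj)
        · rw [List.getD_eq_default _ _ (not_lt.1 hj)]
          decide)
  obtain ⟨b, hb, hsub⟩ := exists_mem_rightLists_subset (fun i => c (.inl i)) fun i => hc (.inl i)
  obtain ⟨j, hj, rfl⟩ := List.getElem_of_mem hb
  have hj' : j < 123 := by rw [length_rightLists] at hj; omega
  have hmem := hc (.inr ⟨j, hj'⟩)
  rw [Sum.elim_inr, List.getD_eq_getElem _ _ hj, List.mem_toFinset] at hmem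
  obtain ⟨i, hi⟩ := hsub _ hmem
  exact hadj (.inl i) (.inr ⟨j, hj'⟩) (by simp) hi.symm

theorem choiceNumber_eq_five :
    choiceNumber (completeBipartiteGraph (Fin 6) (Fin 123)) = 5 := by
  refine le_antisymm (Nat.sInf_le K6_123_five_choosable)
    (le_csInf ⟨5, K6_123_five_choosable⟩ fun k hk => ?_)
  by_contra hlt
  exact not_choosable_four (Choosable.mono hk (by omega))

end

/-- `K_{6,123}` is not 4-choosable; equivalently `ch (K_{6,123}) = 5`, hence `n_6 ≤ 123`. -/
theorem K6_123_not_four_choosable :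
    ¬ Choosable (completeBipartiteGraph (Fin 6) (Fin 123)) 4 ∧
      choiceNumber (completeBipartiteGraph (Fin 6) (Fin 123)) = 5 ∧ nm 6 ≤ 123 := by
  exact ⟨not_choosable_four, choiceNumber_eq_five, Nat.sInf_le choiceNumber_eq_five⟩
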